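/- Let S be a numerical semigroup with multiplicity e and embedding dimension ν. Then: (1) τ ≤ e − ν + 1; (2) if S is M-pure symmetric and 2 < ν < e − 1, then τ ≤ e − 2ν + 3; (3) if S is generated by an arithmetic sequence (i.e., its minimal generators are a_i = a_1 + (i−1)d for some d ≥ 1 with gcd(a_1, d) = 1), then τ = ⌈(e−1)/(ν−1)⌉. -/

import Mathlib

namespace GotoNS

/-- `S` is a numerical semigroup: an additive submonoid of `ℕ` with finite
complement, different from `ℕ` itself. -/
def IsNumericalSemigroup (S : Set ℕ) : Prop :=
  (0 : ℕ) ∈ S ∧ (∀ a b, a ∈ S → b ∈ S → a + b ∈ S) ∧ Sᶜ.Finite ∧ S ≠ Set.univ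

/-- The multiplicity `e` of `S`: its smallest nonzero element. -/
noncomputable def mult (S : Set ℕ) : ℕ := sInf {n | n ∈ S ∧ n ≠ 0}

/-- The Frobenius number `f` of `S`: the largest integer not in `S`. -/
noncomputable def frob (S : Set ℕ) : ℕ := sSup {n | n ∉ S}

/-- The `k`-fold sumset `kM` of `M = S \ {0}` (with `0M = {0}`). -/
def kfold (S : Set ℕ) (k : ℕ) : Set ℕ :=
  {s | ∃ c : Fin k → ℕ, (∀ i, c i ∈ S ∧ c i ≠ 0) ∧ ∑ i, c i = s}

/-- The order of `s`: the largest `k` such that `s` is a sum of `k` nonzero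
elements of `S` (`ord 0 = 0`; junk value `0` off `S`). -/
noncomputable def ordS (S : Set ℕ) (s : ℕ) : ℕ := sSup {k | s ∈ kfold S k}

/-- The Apéry set `Ap(S; n) = {w ∈ S | w - n ∉ S}`. -/
def apery (S : Set ℕ) (n : ℕ) : Set ℕ := {w | w ∈ S ∧ ∀ s ∈ S, s + n ≠ w}

/-- `σ(α) = max {ord w | w ∈ Ap(S; α)}`. -/
noncomputable def sigmaS (S : Set ℕ) (α : ℕ) : ℕ := sSup (ordS S '' apery S α)

/-- `𝒜(u) = {α ∈ {1, …, e} | u - α ∈ S}`. -/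
def Aset (S : Set ℕ) (u : ℕ) : Set ℕ :=
  {α | 1 ≤ α ∧ α ≤ mult S ∧ ∃ s ∈ S, s + α = u}

/-- The Goto number `g(u) = min {σ(α) | α ∈ 𝒜(u)}`. -/
noncomputable def goto (S : Set ℕ) (u : ℕ) : ℕ := sInf (sigmaS S '' Aset S u)

/-- `τ`: the minimal Goto number of a nonzero element of `S`. -/
noncomputable def tau (S : Set ℕ) : ℕ := sInf (goto S '' {u | u ∈ S ∧ u ≠ 0})

/-- `ρ`: the maximal Goto number of a nonzero element of `S`. -/
noncomputable def rho (S : Set ℕ) : ℕ := sSup (goto S '' {u | u ∈ S ∧ u ≠ 0})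

/-- An integer belongs to `S` (viewed inside `ℤ`). -/
def memZ (S : Set ℕ) (z : ℤ) : Prop := ∃ n : ℕ, n ∈ S ∧ (n : ℤ) = z

/-- `T = {z ∈ ℤ \ S | z + u ∈ S for all 0 ≠ u ∈ S}`. -/
def Tset (S : Set ℕ) : Set ℤ :=
  {z | ¬ memZ S z ∧ ∀ u : ℕ, u ∈ S → u ≠ 0 → memZ S (z + (u : ℤ))}

open Classical in
/-- The order of an integer, with the convention `ord z = -1` if `z ∉ S`. -/
noncomputable def ordZ (S : Set ℕ) (z : ℤ) : ℤ :=
  if 0 ≤ z ∧ z.toNat ∈ S then (ordS S z.toNat : ℤ) else -1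

/-- `S` is symmetric: for integers `x + y = f`, exactly one of `x, y` lies in `S`. -/
def IsSymmetricNS (S : Set ℕ) : Prop :=
  ∀ x y : ℤ, x + y = (frob S : ℤ) → (memZ S x ↔ ¬ memZ S y)

/-- `u ⪯ u'` iff `u' - u ∈ S`. -/
def preceq (S : Set ℕ) (u u' : ℕ) : Prop := ∃ s ∈ S, u + s = u'

/-- `u ⪯_M u'` iff `u + s = u'` and `ord u + ord s = ord u'` for some `s ∈ S`. -/
def preceqM (S : Set ℕ) (u u' : ℕ) : Prop :=
  ∃ s ∈ S, u + s = u' ∧ ordS S u + ordS S s = ordS S u'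

/-- `Ap(S) \ {0}`. -/
def apNZ (S : Set ℕ) : Set ℕ := apery S (mult S) \ {0}

/-- Minimal elements of `Ap(S) \ {0}` with respect to `⪯`. -/
def minAp (S : Set ℕ) : Set ℕ := {w | w ∈ apNZ S ∧ ∀ w' ∈ apNZ S, preceq S w' w → w' = w}

/-- Maximal elements of `Ap(S) \ {0}` with respect to `⪯`. -/
def maxAp (S : Set ℕ) : Set ℕ := {w | w ∈ apNZ S ∧ ∀ w' ∈ apNZ S, preceq S w w' → w' = w}

/-- Minimal elements of `Ap(S) \ {0}` with respect to `⪯_M`. -/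
def minApM (S : Set ℕ) : Set ℕ := {w | w ∈ apNZ S ∧ ∀ w' ∈ apNZ S, preceqM S w' w → w' = w}

/-- Maximal elements of `Ap(S) \ {0}` with respect to `⪯_M`. -/
def maxApM (S : Set ℕ) : Set ℕ := {w | w ∈ apNZ S ∧ ∀ w' ∈ apNZ S, preceqM S w w' → w' = w}

/-- `S` is pure if all elements of `maxAp S` have the same order. -/
def IsPure (S : Set ℕ) : Prop := ∀ w ∈ maxAp S, ∀ w' ∈ maxAp S, ordS S w = ordS S w'

/-- `S` is `M`-pure if all elements of `maxApM S` have the same order. -/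
def IsMPure (S : Set ℕ) : Prop := ∀ w ∈ maxApM S, ∀ w' ∈ maxApM S, ordS S w = ordS S w'

/-- `S` is `M`-additive if `ord (u + a₁) = ord u + 1` for all `u ∈ S`. -/
def IsMAdditive (S : Set ℕ) : Prop := ∀ u ∈ S, ordS S (u + mult S) = ordS S u + 1

/-- The reduction number `r = min {k | (k+1)M = a₁ + kM}`. -/
noncomputable def redNum (S : Set ℕ) : ℕ :=
  sInf {k | kfold S (k + 1) = (fun x => mult S + x) '' kfold S k}

/-- The set of minimal generators of `S`: nonzero elements of `S` that are not
sums of two nonzero elements of `S`. -/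
def minGens (S : Set ℕ) : Set ℕ :=
  {a | a ∈ S ∧ a ≠ 0 ∧ ∀ x ∈ S, ∀ y ∈ S, x ≠ 0 → y ≠ 0 → x + y ≠ a}

/-- `δ_w = max {ord w + ord w' | w' ∈ S, w + w' ∈ Ap(S)}`. -/
noncomputable def deltaI (S : Set ℕ) (w : ℕ) : ℕ :=
  sSup ((fun w' => ordS S w + ordS S w') '' {w' | w' ∈ S ∧ w + w' ∈ apery S (mult S)})

/-- `δ = min {δ_w | w ∈ Ap(S)}`. -/
noncomputable def deltaNS (S : Set ℕ) : ℕ := sInf (deltaI S '' apery S (mult S))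

/-- `γ_w = max {ord w + ⌊w'/a₁⌋ | w' ∈ S, w + w' ∈ Ap(S)}`. -/
noncomputable def gammaI (S : Set ℕ) (w : ℕ) : ℕ :=
  sSup ((fun w' => ordS S w + w' / mult S) '' {w' | w' ∈ S ∧ w + w' ∈ apery S (mult S)})

/-- `γ = min {γ_w | w ∈ Ap(S)}`. -/
noncomputable def gammaNS (S : Set ℕ) : ℕ := sInf (gammaI S '' apery S (mult S))

/-- `ord(C) = min {ord (f+1), …, ord (f+a₁)}`. -/
noncomputable def ordC (S : Set ℕ) : ℕ :=
  sInf ((fun α => ordS S (frob S + α)) '' Set.Icc 1 (mult S))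

section Kfold

variable {S : Set ℕ}

theorem mem_kfold_zero {s : ℕ} : s ∈ kfold S 0 ↔ s = 0 := by
  simp [kfold, eq_comm]

theorem mem_kfold_succ {k s : ℕ} :
    s ∈ kfold S (k + 1) ↔ ∃ x ∈ S, x ≠ 0 ∧ ∃ y ∈ kfold S k, x + y = s := by
  constructor
  · rintro ⟨c, hc, rfl⟩
    exact ⟨c 0, (hc 0).1, (hc 0).2, ∑ i : Fin k, c i.succ, ⟨_, fun i => hc i.succ, rfl⟩,
      (Fin.sum_univ_succ c).symm⟩
  · rintro ⟨x, hx, hx0, y, ⟨c, hc, rfl⟩, rfl⟩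
    refine ⟨Fin.cons x c, fun i => ?_, by simp [Fin.sum_univ_succ]⟩
    refine Fin.cases ?_ (fun j => ?_) i
    · exact ⟨hx, hx0⟩
    · exact hc j

theorem le_of_mem_kfold {k s : ℕ} (h : s ∈ kfold S k) : k ≤ s := by
  induction k generalizing s with
  | zero => exact Nat.zero_le _
  | succ k ih =>
    obtain ⟨x, -, hx0, y, hy, rfl⟩ := mem_kfold_succ.1 h
    have := ih hy
    omega

theorem add_mem_kfold {m n x y : ℕ} (hx : x ∈ kfold S m) (hy : y ∈ kfold S n) :
    x + y ∈ kfold S (m + n) := by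
  induction m generalizing x with
  | zero => simpa [mem_kfold_zero.1 hx] using hy
  | succ m ih =>
    obtain ⟨u, hu, hu0, v, hv, rfl⟩ := mem_kfold_succ.1 hx
    rw [Nat.add_right_comm, mem_kfold_succ]
    exact ⟨u, hu, hu0, v + y, ih hv, by ring⟩

theorem exists_add_of_mem_kfold_add {m n s : ℕ} (h : s ∈ kfold S (m + n)) :
    ∃ x ∈ kfold S m, ∃ y ∈ kfold S n, x + y = s := by
  induction m generalizing s with
  | zero => exact ⟨0, mem_kfold_zero.2 rfl, s, by simpa using h, by simp⟩
  | succ m ih =>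
    rw [Nat.add_right_comm, mem_kfold_succ] at h
    obtain ⟨u, hu, hu0, v, hv, rfl⟩ := h
    obtain ⟨x, hx, y, hy, rfl⟩ := ih hv
    exact ⟨u + x, mem_kfold_succ.2 ⟨u, hu, hu0, x, hx, rfl⟩, y, hy, by ring⟩

theorem bddAbove_setOf_mem_kfold (s : ℕ) : BddAbove {k | s ∈ kfold S k} :=
  ⟨s, fun _ h => le_of_mem_kfold h⟩

theorem le_ordS {k s : ℕ} (h : s ∈ kfold S k) : k ≤ ordS S s :=
  le_csSup (bddAbove_setOf_mem_kfold s) h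

theorem mem_kfold_one {s : ℕ} (hs : s ∈ S) (h0 : s ≠ 0) : s ∈ kfold S 1 :=
  mem_kfold_succ.2 ⟨s, hs, h0, 0, mem_kfold_zero.2 rfl, by simp⟩

theorem mem_kfold_ordS {s : ℕ} (hs : s ∈ S) : s ∈ kfold S (ordS S s) := by
  refine Nat.sSup_mem (s := {k | s ∈ kfold S k}) ?_ (bddAbove_setOf_mem_kfold s)
  by_cases h0 : s = 0
  · exact ⟨0, mem_kfold_zero.2 h0⟩
  · exact ⟨1, mem_kfold_one hs h0⟩

theorem ordS_le_self {s : ℕ} (hs : s ∈ S) : ordS S s ≤ s :=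
  le_of_mem_kfold (mem_kfold_ordS hs)

theorem ordS_zero (h : 0 ∈ S) : ordS S 0 = 0 :=
  Nat.le_zero.1 (ordS_le_self h)

theorem eq_zero_of_ordS_eq_zero {s : ℕ} (hs : s ∈ S) (h : ordS S s = 0) : s = 0 := by
  by_contra h0
  have := le_ordS (mem_kfold_one hs h0)
  omega

theorem ordS_add_le {x y : ℕ} (hx : x ∈ S) (hy : y ∈ S) :
    ordS S x + ordS S y ≤ ordS S (x + y) :=
  le_ordS (add_mem_kfold (mem_kfold_ordS hx) (mem_kfold_ordS hy))

end Kfold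

namespace IsNumericalSemigroup

variable {S : Set ℕ}

theorem mem_of_mem_kfold (hS : IsNumericalSemigroup S) {k s : ℕ} (h : s ∈ kfold S k) :
    s ∈ S := by
  induction k generalizing s with
  | zero => rw [mem_kfold_zero.1 h]; exact hS.1
  | succ k ih =>
    obtain ⟨x, hx, -, y, hy, rfl⟩ := mem_kfold_succ.1 h
    exact hS.2.1 _ _ hx (ih hy)

theorem exists_add_of_ordS_eq_add (hS : IsNumericalSemigroup S) {m n s : ℕ} (hs : s ∈ S)
    (h : ordS S s = m + n) :
    ∃ x ∈ S, ∃ y ∈ S, x + y = s ∧ ordS S x = m ∧ ordS S y = n := by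
  have hk := mem_kfold_ordS hs
  rw [h] at hk
  obtain ⟨x, hx, y, hy, rfl⟩ := exists_add_of_mem_kfold_add hk
  have hxS := hS.mem_of_mem_kfold hx
  have hyS := hS.mem_of_mem_kfold hy
  have := ordS_add_le hxS hyS
  have := le_ordS hx
  have := le_ordS hy
  exact ⟨x, hxS, y, hyS, rfl, by omega, by omega⟩

theorem exists_forall_ge_mem (hS : IsNumericalSemigroup S) : ∃ N, ∀ n, N ≤ n → n ∈ S := by
  obtain ⟨B, hB⟩ := hS.2.2.1.bddAbove
  refine ⟨B + 1, fun n hn => ?_⟩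
  by_contra h
  have : n ≤ B := hB h
  omega

theorem mult_mem_and_ne_zero (hS : IsNumericalSemigroup S) : mult S ∈ S ∧ mult S ≠ 0 := by
  obtain ⟨N, hN⟩ := hS.exists_forall_ge_mem
  exact Nat.sInf_mem (s := {n | n ∈ S ∧ n ≠ 0}) ⟨N + 1, hN _ (by omega), by omega⟩

theorem mult_mem (hS : IsNumericalSemigroup S) : mult S ∈ S := hS.mult_mem_and_ne_zero.1

theorem mult_pos (hS : IsNumericalSemigroup S) : 0 < mult S :=
  Nat.pos_of_ne_zero hS.mult_mem_and_ne_zero.2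

theorem mult_le {s : ℕ} (hs : s ∈ S) (h0 : s ≠ 0) : mult S ≤ s :=
  Nat.sInf_le ⟨hs, h0⟩

theorem mul_mem (hS : IsNumericalSemigroup S) {s : ℕ} (hs : s ∈ S) (n : ℕ) : n * s ∈ S := by
  induction n with
  | zero => simpa using hS.1
  | succ n ih => rw [Nat.succ_mul]; exact hS.2.1 _ _ ih hs

theorem one_lt_mult (hS : IsNumericalSemigroup S) : 1 < mult S := by
  have h0 := hS.mult_pos
  by_contra h
  have h1 : mult S = 1 := by omega
  have hm := hS.mult_mem
  rw [h1] at hm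
  exact hS.2.2.2 (Set.eq_univ_of_forall fun n => by simpa using hS.mul_mem hm n)

theorem frob_notMem (hS : IsNumericalSemigroup S) : frob S ∉ S := by
  refine Nat.sSup_mem (s := {n | n ∉ S}) ?_ hS.2.2.1.bddAbove
  by_contra h
  refine hS.2.2.2 (Set.eq_univ_of_forall fun n => ?_)
  by_contra hn
  exact h ⟨n, hn⟩

theorem finite_apery (hS : IsNumericalSemigroup S) (n : ℕ) : (apery S n).Finite := by
  obtain ⟨N, hN⟩ := hS.exists_forall_ge_mem
  refine (Set.finite_Iio (N + n)).subset fun w hw => ?_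
  by_contra h
  have h : N + n ≤ w := by simpa using h
  exact hw.2 (w - n) (hN _ (by omega)) (by omega)

theorem ordS_le_sigmaS (hS : IsNumericalSemigroup S) {n w : ℕ} (hw : w ∈ apery S n) :
    ordS S w ≤ sigmaS S n :=
  le_csSup ((hS.finite_apery n).image _).bddAbove ⟨w, hw, rfl⟩

theorem zero_mem_apery (hS : IsNumericalSemigroup S) {n : ℕ} (hn : 0 < n) : 0 ∈ apery S n :=
  ⟨hS.1, fun s _ => by omega⟩

theorem exists_ordS_eq_sigmaS (hS : IsNumericalSemigroup S) {n : ℕ} (hn : 0 < n) :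
    ∃ w ∈ apery S n, ordS S w = sigmaS S n :=
  Nat.sSup_mem (s := ordS S '' apery S n) ⟨_, 0, hS.zero_mem_apery hn, rfl⟩
    ((hS.finite_apery n).image _).bddAbove

theorem mem_apery_of_add_mem (hS : IsNumericalSemigroup S) {n x y : ℕ} (hx : x ∈ S)
    (hy : y ∈ S) (h : x + y ∈ apery S n) : x ∈ apery S n := by
  refine ⟨hx, fun s hs hsx => h.2 (s + y) (hS.2.1 _ _ hs hy) ?_⟩
  omega

theorem tau_le_sigmaS_mult (hS : IsNumericalSemigroup S) : tau S ≤ sigmaS S (mult S) :=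
  (Nat.sInf_le ⟨mult S, hS.mult_mem_and_ne_zero, rfl⟩ : tau S ≤ goto S (mult S)).trans
    (Nat.sInf_le ⟨mult S, ⟨hS.mult_pos, le_rfl, 0, hS.1, by simp⟩, rfl⟩)

theorem le_tau (hS : IsNumericalSemigroup S) {q : ℕ}
    (h : ∀ α, 1 ≤ α → α ≤ mult S → q ≤ sigmaS S α) : q ≤ tau S := by
  refine le_csInf ⟨_, mult S, hS.mult_mem_and_ne_zero, rfl⟩ ?_
  rintro _ ⟨u, ⟨hu, hu0⟩, rfl⟩
  refine le_csInf (Set.Nonempty.image _ ?_) ?_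
  · have h1 := Nat.div_add_mod (u - 1) (mult S)
    have h2 := Nat.mod_lt (u - 1) hS.mult_pos
    refine ⟨(u - 1) % mult S + 1, by omega, by omega, _,
      hS.mul_mem hS.mult_mem ((u - 1) / mult S), ?_⟩
    rw [mul_comm]
    omega
  · rintro _ ⟨α, ⟨h1, h2, -⟩, rfl⟩
    exact h α h1 h2

theorem bijOn_mod_mult_apery (hS : IsNumericalSemigroup S) :
    Set.BijOn (· % mult S) (apery S (mult S)) (Set.Iio (mult S)) := by
  have hinj : ∀ w ∈ apery S (mult S), ∀ w' ∈ apery S (mult S),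
      w % mult S = w' % mult S → w ≤ w' := by
    intro w hw w' hw' h
    by_contra! hlt
    obtain ⟨c, hc⟩ := (Nat.modEq_iff_dvd' hlt.le).1 (show w' ≡ w [MOD mult S] from h.symm)
    obtain _ | c := c
    · omega
    refine hw.2 (w' + c * mult S) (hS.2.1 _ _ hw'.1 (hS.mul_mem hS.mult_mem c)) ?_
    rw [Nat.mul_succ, mul_comm] at hc
    omega
  refine ⟨fun w _ => Nat.mod_lt _ hS.mult_pos,
    fun w hw w' hw' h => le_antisymm (hinj w hw w' hw' h) (hinj w' hw' w hw h.symm), ?_⟩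
  intro i hi
  have hi : i < mult S := hi
  obtain ⟨N, hN⟩ := hS.exists_forall_ge_mem
  have hne : ∃ s, s ∈ S ∧ s % mult S = i := by
    refine ⟨i + mult S * N, hN _ ?_, by simp [Nat.mod_eq_of_lt hi]⟩
    have := Nat.le_mul_of_pos_left N hS.mult_pos
    omega
  classical
  refine ⟨Nat.find hne, ⟨(Nat.find_spec hne).1, fun s hs hse => ?_⟩, (Nat.find_spec hne).2⟩
  have hpos := hS.mult_pos
  refine Nat.find_min hne (m := s) (by omega) ⟨hs, ?_⟩
  rw [← (Nat.find_spec hne).2, ← hse, Nat.add_mod_right]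

theorem ncard_apery_mult (hS : IsNumericalSemigroup S) : (apery S (mult S)).ncard = mult S := by
  rw [← hS.bijOn_mod_mult_apery.injOn.ncard_image,
    hS.bijOn_mod_mult_apery.image_eq]
  simp [Set.ncard_eq_toFinset_card']

theorem mem_minGens_iff (hS : IsNumericalSemigroup S) {a : ℕ} :
    a ∈ minGens S ↔ a ∈ S ∧ ordS S a = 1 := by
  constructor
  · rintro ⟨ha, h0, h⟩
    refine ⟨ha, ?_⟩
    have h1 := le_ordS (mem_kfold_one ha h0)
    by_contra hne
    obtain ⟨x, hx, y, hy, hxy, hox, hoy⟩ :=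
      hS.exists_add_of_ordS_eq_add ha (show ordS S a = 1 + (ordS S a - 1) by omega)
    refine h x hx y hy ?_ ?_ hxy
    · rintro rfl
      rw [ordS_zero hS.1] at hox
      omega
    · rintro rfl
      rw [ordS_zero hS.1] at hoy
      omega
  · rintro ⟨ha, h1⟩
    refine ⟨ha, ?_, fun x hx y hy hx0 hy0 hxy => ?_⟩
    · rintro rfl
      rw [ordS_zero hS.1] at h1
      omega
    · subst hxy
      have := le_ordS (add_mem_kfold (mem_kfold_one hx hx0) (mem_kfold_one hy hy0))
      omega

theorem mult_mem_minGens (hS : IsNumericalSemigroup S) : mult S ∈ minGens S := by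
  refine ⟨hS.mult_mem, hS.mult_mem_and_ne_zero.2, fun x hx y hy hx0 hy0 hxy => ?_⟩
  have := mult_le hx hx0
  omega

theorem minGens_diff_mult (hS : IsNumericalSemigroup S) :
    minGens S \ {mult S} = {w ∈ apery S (mult S) | ordS S w = 1} := by
  ext a
  constructor
  · rintro ⟨ha, hne⟩
    have h := hS.mem_minGens_iff.1 ha
    refine ⟨⟨h.1, fun s hs hsa => ha.2.2 s hs _ hS.mult_mem ?_ hS.mult_mem_and_ne_zero.2 hsa⟩,
      h.2⟩
    rintro rfl
    exact hne (by simpa using hsa.symm)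
  · rintro ⟨ha, h1⟩
    refine ⟨hS.mem_minGens_iff.2 ⟨ha.1, h1⟩, ?_⟩
    rintro rfl
    exact ha.2 0 hS.1 (by simp)

theorem ncard_ordS_eq_one (hS : IsNumericalSemigroup S) :
    {w ∈ apery S (mult S) | ordS S w = 1}.ncard + 1 = (minGens S).ncard := by
  have hfin : (minGens S).Finite := by
    refine Set.Finite.of_sdiff (t := {mult S}) ?_ (Set.finite_singleton _)
    rw [hS.minGens_diff_mult]
    exact (hS.finite_apery _).subset fun _ h => h.1
  rw [← hS.minGens_diff_mult]
  exact Set.ncard_sdiff_singleton_add_one hS.mult_mem_minGens hfin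

theorem ncard_ordS_eq_pos (hS : IsNumericalSemigroup S) {i : ℕ} (hi : i ≤ sigmaS S (mult S)) :
    1 ≤ {w ∈ apery S (mult S) | ordS S w = i}.ncard := by
  obtain ⟨w, hw, hwr⟩ := hS.exists_ordS_eq_sigmaS hS.mult_pos
  obtain ⟨x, hx, y, hy, rfl, hox, -⟩ := hS.exists_add_of_ordS_eq_add hw.1
    (show ordS S w = i + (sigmaS S (mult S) - i) by omega)
  exact (Set.ncard_pos ((hS.finite_apery _).subset fun _ h => h.1)).2
    ⟨x, hS.mem_apery_of_add_mem hx hy hw, hox⟩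

theorem mult_eq_sum_ncard (hS : IsNumericalSemigroup S) :
    mult S = ∑ i ∈ Finset.range (sigmaS S (mult S) + 1),
      {w ∈ apery S (mult S) | ordS S w = i}.ncard := by
  classical
  conv_lhs => rw [← hS.ncard_apery_mult, Set.ncard_eq_toFinset_card _ (hS.finite_apery _)]
  rw [Finset.card_eq_sum_card_fiberwise (f := ordS S)
    (t := Finset.range (sigmaS S (mult S) + 1))]
  · refine Finset.sum_congr rfl fun i _ => ?_
    rw [← Set.ncard_coe_finset]
    congr 1
    ext w
    simp
  · intro w hw
    have : w ∈ apery S (mult S) := by simpa using hw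
    have := hS.ordS_le_sigmaS this
    simp
    omega

theorem sigmaS_mult_add_ncard_le (hS : IsNumericalSemigroup S) :
    sigmaS S (mult S) + (minGens S).ncard ≤ mult S + 1 := by
  have hsum := hS.mult_eq_sum_ncard
  have hone := hS.ncard_ordS_eq_one
  have hpos := fun i => hS.ncard_ordS_eq_pos (i := i)
  generalize sigmaS S (mult S) = r at *
  obtain _ | r := r
  · have : (minGens S).ncard ≤ mult S + 1 := by
      have := Set.ncard_le_ncard (s := {w ∈ apery S (mult S) | ordS S w = 1})
        (fun _ h => h.1) (hS.finite_apery _)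
      rw [hS.ncard_apery_mult] at this
      omega
    omega
  · rw [Finset.sum_range_succ', Finset.sum_range_succ'] at hsum
    have h0 := hpos 0 (by omega)
    have := Finset.card_nsmul_le_sum (Finset.range r)
      (fun i => {w ∈ apery S (mult S) | ordS S w = i + 1 + 1}.ncard) 1
      (fun i hi => hpos _ (by have := Finset.mem_range.1 hi; omega))
    simp only [Finset.card_range, smul_eq_mul, mul_one] at this
    simp only [zero_add] at hsum
    omega

theorem mem_apery_frob_add_mult (hS : IsNumericalSemigroup S) (hsym : IsSymmetricNS S) :
    frob S + mult S ∈ apery S (mult S) := by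
  have hpos := hS.mult_pos
  refine ⟨?_, fun s hs h => hS.frob_notMem ?_⟩
  · obtain ⟨n, hn, hn'⟩ := (hsym ((frob S + mult S : ℕ) : ℤ) (-(mult S : ℤ)) (by push_cast; ring)).2
      (by rintro ⟨n, -, hn⟩; omega)
    rwa [← Nat.cast_injective (R := ℤ) hn']
  · rwa [← Nat.add_right_cancel h]

theorem exists_add_eq_frob_add_mult (hsym : IsSymmetricNS S)
    {w : ℕ} (hw : w ∈ apery S (mult S)) : ∃ s ∈ S, w + s = frob S + mult S := by
  obtain ⟨n, hn, hn'⟩ := (hsym ((frob S : ℤ) + mult S - w) (w - mult S) (by ring)).2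
    (by rintro ⟨n, hn, hn'⟩; exact hw.2 n hn (by omega))
  exact ⟨n, hn, by omega⟩

theorem preceqM_trans (hS : IsNumericalSemigroup S) {u v w : ℕ} (hu : u ∈ S)
    (huv : preceqM S u v) (hvw : preceqM S v w) : preceqM S u w := by
  obtain ⟨s, hs, rfl, h1⟩ := huv
  obtain ⟨t, ht, rfl, h2⟩ := hvw
  refine ⟨s + t, hS.2.1 _ _ hs ht, by ring, ?_⟩
  have h3 := ordS_add_le hs ht
  have h4 := ordS_add_le hu (hS.2.1 _ _ hs ht)
  rw [← add_assoc] at h4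
  omega

theorem exists_mem_maxApM (hS : IsNumericalSemigroup S) {w : ℕ} (hw : w ∈ apNZ S) :
    ∃ w' ∈ maxApM S, preceqM S w w' := by
  have hfin : {v | v ∈ apNZ S ∧ preceqM S w v}.Finite :=
    (hS.finite_apery (mult S)).subset fun v hv => hv.1.1
  obtain ⟨m, ⟨hm, hwm⟩, hmax⟩ := hfin.exists_maximalFor id _
    ⟨w, hw, 0, hS.1, by simp, by simp [ordS_zero hS.1]⟩
  refine ⟨m, ⟨hm, fun v hv hmv => ?_⟩, hwm⟩
  have hle : v ≤ m := by
    by_contra hlt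
    exact hlt (hmax ⟨hv, hS.preceqM_trans hw.1.1 hwm hmv⟩ (by simp only [id]; omega))
  obtain ⟨s, -, h, -⟩ := hmv
  omega

theorem preceqM_frob_add_mult (hS : IsNumericalSemigroup S) (hsym : IsSymmetricNS S)
    (hpure : IsMPure S) {w : ℕ} (hw : w ∈ apery S (mult S)) :
    preceqM S w (frob S + mult S) := by
  have hpos := hS.mult_pos
  have hF := hS.mem_apery_frob_add_mult hsym
  by_cases h0 : w = 0
  · subst h0
    exact ⟨_, hF.1, by simp, by simp [ordS_zero hS.1]⟩
  obtain ⟨m, hm, hwm⟩ := hS.exists_mem_maxApM (w := w) ⟨hw, h0⟩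
  have hFmax : frob S + mult S ∈ maxApM S := by
    refine ⟨⟨hF, by simp; omega⟩, ?_⟩
    rintro v hv ⟨s, -, hs, -⟩
    obtain ⟨t, -, ht⟩ := exists_add_eq_frob_add_mult hsym hv.1
    omega
  obtain ⟨s, hs, hms⟩ := exists_add_eq_frob_add_mult hsym hm.1.1
  have h1 := ordS_add_le hm.1.1.1 hs
  rw [hms, hpure _ hm _ hFmax] at h1
  have hs0 := eq_zero_of_ordS_eq_zero hs (by omega)
  rw [← hms, hs0]
  exact hwm

theorem sigmaS_mult_add_two_mul_ncard_le (hS : IsNumericalSemigroup S) (hpure : IsMPure S)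
    (hsym : IsSymmetricNS S) (hν : (minGens S).ncard < mult S - 1) :
    sigmaS S (mult S) + 2 * (minGens S).ncard ≤ mult S + 3 := by
  have hF := hS.mem_apery_frob_add_mult hsym
  have hprec := fun w => hS.preceqM_frob_add_mult hsym hpure (w := w)
  have hr : ordS S (frob S + mult S) = sigmaS S (mult S) := by
    refine le_antisymm (hS.ordS_le_sigmaS hF) ?_
    obtain ⟨w, hw, hwr⟩ := hS.exists_ordS_eq_sigmaS hS.mult_pos
    obtain ⟨s, -, -, h⟩ := hprec w hw
    omega
  have hfib : ∀ i, {w ∈ apery S (mult S) | ordS S w = i}.Finite := fun i =>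
    (hS.finite_apery _).subset fun _ h => h.1
  have hsum := hS.mult_eq_sum_ncard
  have hone := hS.ncard_ordS_eq_one
  have hpos := fun i => hS.ncard_ordS_eq_pos (i := i)
  have hdual : {w ∈ apery S (mult S) | ordS S w = 1}.ncard ≤
      {w ∈ apery S (mult S) | ordS S w = sigmaS S (mult S) - 1}.ncard := by
    refine Set.ncard_le_ncard_of_injOn (fun w => frob S + mult S - w) ?_ ?_ (hfib _)
    · rintro w ⟨hw, hw1⟩
      obtain ⟨s, hs, hws, ho⟩ := hprec w hw
      have hsub : frob S + mult S - w = s := by omega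
      simp only [hsub]
      exact ⟨hS.mem_apery_of_add_mem hs hw.1 (by rwa [add_comm, hws]), by omega⟩
    · rintro w ⟨hw, -⟩ v ⟨hv, -⟩ h
      obtain ⟨s, -, hws, -⟩ := hprec w hw
      obtain ⟨t, -, hvt, -⟩ := hprec v hv
      simp only at h
      omega
  have hzero : {w ∈ apery S (mult S) | ordS S w = 0}.ncard ≤ 1 := by
    refine (Set.ncard_le_one (hfib 0)).2 ?_
    rintro a ⟨ha, ha0⟩ b ⟨hb, hb0⟩
    rw [eq_zero_of_ordS_eq_zero ha.1 ha0, eq_zero_of_ordS_eq_zero hb.1 hb0]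
  have htop : {w ∈ apery S (mult S) | ordS S w = sigmaS S (mult S)}.ncard ≤ 1 := by
    have heq : ∀ w ∈ apery S (mult S), ordS S w = sigmaS S (mult S) →
        w = frob S + mult S := by
      intro w hw hwr
      obtain ⟨s, hs, hws, ho⟩ := hprec w hw
      have := eq_zero_of_ordS_eq_zero hs (by omega)
      omega
    refine (Set.ncard_le_one (hfib _)).2 ?_
    rintro a ⟨ha, har⟩ b ⟨hb, hbr⟩
    rw [heq a ha har, heq b hb hbr]
  clear hr
  generalize sigmaS S (mult S) = r at *
  obtain _ | _ | _ | t := r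
  · simp only [zero_add, Finset.sum_range_one] at hsum
    omega
  · simp only [zero_add, Finset.sum_range_succ, Finset.sum_range_zero] at hsum
    omega
  · simp only [zero_add, Finset.sum_range_succ, Finset.sum_range_zero, Nat.reduceAdd]
      at hsum htop
    omega
  · rw [Finset.sum_range_succ, Finset.sum_range_succ, Finset.sum_range_succ',
      Finset.sum_range_succ'] at hsum
    have h0 := hpos 0 (by omega)
    have hlast := hpos (t + 1 + 1 + 1) (by omega)
    have := Finset.card_nsmul_le_sum (Finset.range t)
      (fun i => {w ∈ apery S (mult S) | ordS S w = i + 1 + 1}.ncard) 1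
      (fun i hi => hpos _ (by have := Finset.mem_range.1 hi; omega))
    simp only [Finset.card_range, smul_eq_mul, mul_one] at this
    simp only [zero_add, add_assoc, Nat.reduceAdd, Nat.reduceSubDiff]
      at hsum hdual hlast this
    omega

section Arithmetic

variable {d k : ℕ}

theorem exists_eq_ordS_mul_add (hS : IsNumericalSemigroup S)
    (hgens : ∀ m ∈ minGens S, ∃ i ≤ k, m = mult S + i * d) {s : ℕ} (hs : s ∈ S) :
    ∃ i ≤ ordS S s * k, s = ordS S s * mult S + i * d := by
  generalize hn : ordS S s = n
  induction n generalizing s with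
  | zero => exact ⟨0, by simp, by simp [eq_zero_of_ordS_eq_zero hs hn]⟩
  | succ n ih =>
    obtain ⟨x, hx, y, hy, rfl, hox, hoy⟩ := hS.exists_add_of_ordS_eq_add hs hn
    obtain ⟨i, hi, rfl⟩ := ih hx hox
    obtain ⟨j, hj, rfl⟩ := hgens y (hS.mem_minGens_iff.2 ⟨hy, hoy⟩)
    exact ⟨i + j, by rw [Nat.succ_mul]; omega, by ring⟩

theorem mul_add_mem_kfold (hS : IsNumericalSemigroup S)
    (hgens : ∀ i ≤ k, mult S + i * d ∈ S) {n i : ℕ} (hi : i ≤ n * k) :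
    n * mult S + i * d ∈ kfold S n := by
  have hpos := hS.mult_pos
  induction n generalizing i with
  | zero =>
    have : i = 0 := by simpa using hi
    simp [this, mem_kfold_zero]
  | succ n ih =>
    rw [Nat.succ_mul] at hi
    rw [mem_kfold_succ]
    refine ⟨mult S + min i k * d, hgens _ (min_le_right _ _), by omega,
      n * mult S + (i - min i k) * d, ih (by omega), ?_⟩
    obtain ⟨j, hj⟩ := Nat.exists_eq_add_of_le (min_le_left i k)
    have h1 : i - min i k = j := by omega
    rw [h1]
    conv_rhs => rw [hj]
    ring

theorem pos_of_arithmetic (hS : IsNumericalSemigroup S)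
    (hgens : ∀ m ∈ minGens S, ∃ i ≤ k, m = mult S + i * d) : 0 < k := by
  by_contra hk
  have hk : k = 0 := by omega
  subst hk
  have hdvd : ∀ s ∈ S, mult S ∣ s := fun s hs => by
    obtain ⟨i, hi, h⟩ := hS.exists_eq_ordS_mul_add hgens hs
    have : i = 0 := by simpa using hi
    rw [h, this]
    simp
  obtain ⟨N, hN⟩ := hS.exists_forall_ge_mem
  have h1 := (Nat.dvd_add_right (hdvd N (hN _ le_rfl))).1 (hdvd (N + 1) (hN _ (by omega)))
  have := hS.one_lt_mult
  have := Nat.le_of_dvd one_pos h1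
  omega

theorem sigmaS_mult_le_of_arithmetic (hS : IsNumericalSemigroup S) (hd : 1 ≤ d)
    (hgens : ∀ m ∈ minGens S, ∃ i ≤ k, m = mult S + i * d)
    (hgens' : ∀ i ≤ k, mult S + i * d ∈ S) {q : ℕ} (hq : mult S - 1 ≤ q * k) :
    sigmaS S (mult S) ≤ q := by
  obtain ⟨w, hw, hwr⟩ := hS.exists_ordS_eq_sigmaS hS.mult_pos
  rw [← hwr]
  by_contra! hlt
  obtain ⟨i, hi, h⟩ := hS.exists_eq_ordS_mul_add hgens hw.1
  obtain ⟨n, hn⟩ : ∃ n, ordS S w = n + 1 := ⟨ordS S w - 1, by omega⟩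
  rw [hn] at h hi hlt
  have hmem : ∀ {n i : ℕ}, i ≤ n * k → n * mult S + i * d ∈ S := fun hi =>
    hS.mem_of_mem_kfold (hS.mul_add_mem_kfold hgens' hi)
  by_cases hie : mult S ≤ i
  · obtain ⟨j, rfl⟩ := Nat.exists_eq_add_of_le hie
    obtain ⟨c, rfl⟩ := Nat.exists_eq_add_of_le hd
    refine hw.2 ((n + 1 + c) * mult S + j * (1 + c)) (hmem ?_) (by rw [h]; ring)
    rw [add_mul (n + 1) c k]
    omega
  · refine hw.2 (n * mult S + i * d) (hmem ?_) (by rw [h]; ring)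
    have : q * k ≤ n * k := Nat.mul_le_mul_right k (by omega)
    omega

theorem le_sigmaS_of_arithmetic (hS : IsNumericalSemigroup S) (hcop : Nat.Coprime (mult S) d)
    (hgens : ∀ m ∈ minGens S, ∃ i ≤ k, m = mult S + i * d)
    (hgens' : ∀ i ≤ k, mult S + i * d ∈ S) {q : ℕ} (hq : mult S - 1 ≤ q * k)
    (hqmin : ∀ n, mult S - 1 ≤ n * k → q ≤ n) {α : ℕ} (hα : 1 ≤ α) :
    q ≤ sigmaS S α := by
  have hpos := hS.mult_pos
  have hcopZ : IsCoprime (mult S : ℤ) (d : ℤ) := Nat.isCoprime_iff_coprime.2 hcop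
  obtain ⟨j, hj, m, hm⟩ :
      ∃ j : ℕ, j < mult S ∧ ∃ m : ℤ, ((j : ℤ) + 1) * d = α + m * mult S := by
    obtain ⟨x, y, hxy⟩ := hcopZ
    have hE : (0 : ℤ) < mult S := by exact_mod_cast hpos
    have h1 := Int.emod_nonneg (α * y - 1) hE.ne'
    have h2 := Int.emod_lt_of_pos (α * y - 1) hE
    have h3 := Int.mul_ediv_add_emod (α * y - 1) (mult S)
    refine ⟨((α * y - 1) % mult S).toNat, by omega,
      -(α * x) - (α * y - 1) / mult S * d, ?_⟩
    rw [Int.toNat_of_nonneg h1]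
    linear_combination (d : ℤ) * h3 + α * hxy
  have hk := hS.mul_add_mem_kfold hgens' (show j ≤ q * k by omega)
  refine (le_ordS hk).trans (hS.ordS_le_sigmaS ⟨hS.mem_of_mem_kfold hk, fun s hs hsw => ?_⟩)
  obtain ⟨i, hi, h⟩ := hS.exists_eq_ordS_mul_add hgens hs
  generalize ordS S s = n at *
  subst h
  zify at hsw
  have hkey : ((i : ℤ) + 1) * d = (q + m - n) * mult S := by
    linear_combination hsw + hm
  obtain ⟨c, hc⟩ : (mult S : ℤ) ∣ (i : ℤ) + 1 :=
    hcopZ.dvd_of_dvd_mul_right ⟨q + m - n, by rw [hkey]; ring⟩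
  have hc1 : 1 ≤ c := by
    by_contra! hc0
    have : (mult S : ℤ) * c ≤ 0 := mul_nonpos_of_nonneg_of_nonpos (by positivity) (by omega)
    omega
  have hcd : c * d = q + m - n := by
    have hE : (mult S : ℤ) ≠ 0 := by exact_mod_cast hpos.ne'
    refine mul_left_cancel₀ hE ?_
    rw [← mul_assoc, ← hc, hkey]
    ring
  have hie : mult S ≤ i + 1 := by
    have : (mult S : ℤ) * 1 ≤ mult S * c := mul_le_mul_of_nonneg_left hc1 (by positivity)
    omega
  have hqn := hqmin n (by omega)
  have hmd : (d : ℤ) ≤ m := by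
    have : (d : ℤ) ≤ c * d := le_mul_of_one_le_left (by positivity) hc1
    omega
  have h1 : (mult S : ℤ) * d ≤ m * mult S := by
    rw [mul_comm m]
    exact mul_le_mul_of_nonneg_left hmd (by positivity)
  have h2 : ((j : ℤ) + 1) * d ≤ mult S * d :=
    mul_le_mul_of_nonneg_right (by exact_mod_cast hj) (by positivity)
  omega

end Arithmetic

end IsNumericalSemigroup

/-- bounds and values of `τ` in terms of `e` and `ν`. -/
theorem statement18 (S : Set ℕ) (hS : IsNumericalSemigroup S) :
    (tau S : ℤ) ≤ (mult S : ℤ) - (minGens S).ncard + 1 ∧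
    (IsMPure S → IsSymmetricNS S → 2 < (minGens S).ncard →
      (minGens S).ncard < mult S - 1 →
      (tau S : ℤ) ≤ (mult S : ℤ) - 2 * (minGens S).ncard + 3) ∧
    (∀ d : ℕ, 1 ≤ d → Nat.gcd (mult S) d = 1 →
      (∀ m, m ∈ minGens S ↔ ∃ i < (minGens S).ncard, m = mult S + i * d) →
      tau S = (mult S - 1 + ((minGens S).ncard - 1) - 1) / ((minGens S).ncard - 1)) := by
  refine ⟨?_, fun hpure hsym _ hν => ?_, fun d hd hcop hgens => ?_⟩
  · have h1 := hS.tau_le_sigmaS_mult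
    have h2 := hS.sigmaS_mult_add_ncard_le
    omega
  · have h1 := hS.tau_le_sigmaS_mult
    have h2 := hS.sigmaS_mult_add_two_mul_ncard_le hpure hsym hν
    omega
  · have hone := hS.ncard_ordS_eq_one
    have hg : ∀ m ∈ minGens S, ∃ i ≤ (minGens S).ncard - 1, m = mult S + i * d := by
      intro m hm
      obtain ⟨i, hi, h⟩ := (hgens m).1 hm
      exact ⟨i, by omega, h⟩
    have hg' : ∀ i ≤ (minGens S).ncard - 1, mult S + i * d ∈ S := fun i hi =>
      ((hgens _).2 ⟨i, by omega, rfl⟩).1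
    have hk := hS.pos_of_arithmetic hg
    generalize (minGens S).ncard - 1 = k at *
    have hq : mult S - 1 ≤ (mult S - 1 + k - 1) / k * k := by
      have h1 := Nat.div_add_mod (mult S - 1 + k - 1) k
      have h2 := Nat.mod_lt (mult S - 1 + k - 1) hk
      rw [mul_comm] at h1
      omega
    have hqmin : ∀ n, mult S - 1 ≤ n * k → (mult S - 1 + k - 1) / k ≤ n := by
      intro n hn
      refine Nat.lt_succ_iff.1 ((Nat.div_lt_iff_lt_mul hk).2 ?_)
      rw [Nat.succ_mul]
      omega
    exact le_antisymm
      (hS.tau_le_sigmaS_mult.trans (hS.sigmaS_mult_le_of_arithmetic hd hg hg' hq))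
      (hS.le_tau fun α hα _ => hS.le_sigmaS_of_arithmetic hcop hg hg' hq hqmin hα)

end GotoNS
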